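/- Let F ∈ 𝓕₁(I) be strictly increasing and let f ∈ 𝓕(I) be a strictly increasing iterative root of F of order n ≥ 1. Then there is a subinterval I' ∈ I(F) with f(I') ⊆ I'. Moreover, there exists a function κ_f : {0,1,…,m} → {1,…,m} such that for each i ∈ {0,1,…,m} there exists K ∈ Λ(F) satisfying: (i) f^(κ_f(i))(I_i) ⊆ K; (ii) f^k(I_i) ⊄ K for 1 ≤ k ≤ κ_f(i)−1; and (iii) f^p(I_i) ∩ f^q(I_i) = ∅ whenever 1 ≤ p ≠ q ≤ κ_f(i). -/

import Mathlib

open Set Filter Topology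

/-- Iterates of a multifunction: `Iter F 0 x = {x}`, `Iter F (n+1) x = F (Iter F n x)`. -/
def Iter (F : ℝ → Set ℝ) : ℕ → ℝ → Set ℝ
  | 0 => fun x => {x}
  | n + 1 => fun x => ⋃ y ∈ Iter F n x, F y

/-- Composition of multifunctions: `(G ∘ F)(x) = ⋃ y ∈ F x, G y`. -/
def Comp (G F : ℝ → Set ℝ) : ℝ → Set ℝ := fun x => ⋃ y ∈ F x, G y

/-- Image of a set under a multifunction: `F(A) = ⋃ x ∈ A, F x`. -/
def ImageOf (F : ℝ → Set ℝ) (A : Set ℝ) : Set ℝ := ⋃ x ∈ A, F x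

/-- `F` is a multifunction on `[a,b]`: nonempty compact values contained in `[a,b]`. -/
def MFOn (a b : ℝ) (F : ℝ → Set ℝ) : Prop :=
  ∀ x ∈ Icc a b, (F x).Nonempty ∧ IsCompact (F x) ∧ F x ⊆ Icc a b

/-- Upper semicontinuity of a multifunction at a point, relative to a domain `S`. -/
def USCWithin (S : Set ℝ) (F : ℝ → Set ℝ) (x : ℝ) : Prop :=
  ∀ V : Set ℝ, IsOpen V → F x ⊆ V → ∃ U ∈ 𝓝 x, ∀ y ∈ U ∩ S, F y ⊆ V

/-- Upper semicontinuity on `[a,b]`. -/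
def USCOn (a b : ℝ) (F : ℝ → Set ℝ) : Prop :=
  ∀ x ∈ Icc a b, USCWithin (Icc a b) F x

/-- Strictly increasing multifunction: `max F(x) < min F(y)` whenever `x < y` in `[a,b]`. -/
def SIncOn (a b : ℝ) (F : ℝ → Set ℝ) : Prop :=
  ∀ x ∈ Icc a b, ∀ y ∈ Icc a b, x < y → ∀ u ∈ F x, ∀ v ∈ F y, u < v

/-- Strictly decreasing multifunction: `min F(x) > max F(y)` whenever `x < y` in `[a,b]`. -/
def SDecOn (a b : ℝ) (F : ℝ → Set ℝ) : Prop :=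
  ∀ x ∈ Icc a b, ∀ y ∈ Icc a b, x < y → ∀ u ∈ F x, ∀ v ∈ F y, v < u

/-- The class 𝓕(I) of strictly monotone usc multifunctions on `I = [a,b]`. -/
def ClassF (a b : ℝ) (F : ℝ → Set ℝ) : Prop :=
  MFOn a b F ∧ USCOn a b F ∧ (SIncOn a b F ∨ SDecOn a b F)

/-- The set `J(F)` of jumps (set-valued points) of `F` in `[a,b]`. -/
def Jumps (a b : ℝ) (F : ℝ → Set ℝ) : Set ℝ :=
  {x | x ∈ Icc a b ∧ (F x).Nontrivial}

/-- `k` is the intensity `ζ(F)`: the least `k` with `#J(F^k) = #J(F^{k+1})`. -/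
def IsIntensity (a b : ℝ) (F : ℝ → Set ℝ) (k : ℕ) : Prop :=
  IsLeast {j : ℕ | (Jumps a b (Iter F j)).ncard = (Jumps a b (Iter F (j + 1))).ncard} k

/-- Exclusive multifunctions 𝓕₁(I): members of 𝓕(I) with finitely many jumps and intensity 1. -/
def Exclusive (a b : ℝ) (F : ℝ → Set ℝ) : Prop :=
  ClassF a b F ∧ (Jumps a b F).Finite ∧ IsIntensity a b F 1

/-- Enumeration of the jumps: `c 0 = a`, `c (m+1) = b`, `c` strictly increasing on `{0,…,m+1}`,
and the jumps of `F` are exactly `c 1 < … < c m`.  The subintervals are `I_i = (c i, c (i+1))`. -/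
def JumpEnum (a b : ℝ) (F : ℝ → Set ℝ) (m : ℕ) (c : ℕ → ℝ) : Prop :=
  c 0 = a ∧ c (m + 1) = b ∧ (∀ i j : ℕ, i < j → j ≤ m + 1 → c i < c j) ∧
    Jumps a b F = {x | ∃ i : ℕ, 1 ≤ i ∧ i ≤ m ∧ x = c i}

/-- Hypothesis (H): `F` is strictly increasing, `max F(x) < x` on `(a,b)`, and `max F(b) ≤ b`. -/
def HypH (a b : ℝ) (F : ℝ → Set ℝ) : Prop :=
  SIncOn a b F ∧ (∀ x ∈ Ioo a b, ∀ u ∈ F x, u < x) ∧ (∀ u ∈ F b, u ≤ b)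

/-- The orbit of a point under a monotone self-map of `{0,…,m}` reaches a fixed point after at
most `m` steps, without repetitions at positive times. -/
theorem exists_orbit_fixed_of_monotone {m : ℕ} (hm : 1 ≤ m) (φ : ℕ → ℕ)
    (hle : ∀ i ≤ m, φ i ≤ m) (hmono : ∀ i j, i < j → j ≤ m → φ i ≤ φ j) (i : ℕ) (hi : i ≤ m) :
    ∃ κ, 1 ≤ κ ∧ κ ≤ m ∧ φ (φ^[κ] i) = φ^[κ] i ∧
      ∀ p q, 1 ≤ p → p < q → q ≤ κ → φ^[p] i ≠ φ^[q] i := by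
  have hs (t : ℕ) : φ^[t + 1] i = φ (φ^[t] i) := Function.iterate_succ_apply' φ t i
  have hsm (t : ℕ) : φ^[t] i ≤ m := by
    induction t with
    | zero => simpa using hi
    | succ t ih => rw [hs]; exact hle _ ih
  rcases lt_trichotomy (φ i) i with h | h | h
  · have hanti (t : ℕ) : φ^[t + 1] i ≤ φ^[t] i := by
      induction t with
      | zero => simpa using h.le
      | succ t ih =>
        rcases ih.lt_or_eq with h' | h'
        · rw [hs (t + 1), hs t]; exact hs t ▸ hmono _ _ h' (hsm t)
        · rw [hs (t + 1), h', ← hs t, h']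
    have hbound (t : ℕ) (ht : ∀ r < t, φ (φ^[r] i) ≠ φ^[r] i) : φ^[t] i + t ≤ i := by
      induction t with
      | zero => simp
      | succ t ih =>
        have h1 := ih fun r hr => ht r (by omega)
        have h2 := ht t (by omega)
        have h3 := hanti t
        rw [hs] at h3 ⊢
        omega
    have hex : ∃ t, φ (φ^[t] i) = φ^[t] i := by
      by_contra! hne
      have := hbound (m + 1) fun r _ => hne r
      omega
    classical
    have hmin : ∀ r < Nat.find hex, φ (φ^[r] i) ≠ φ^[r] i := fun r hr => Nat.find_min hex hr
    have hspec := Nat.find_spec hex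
    refine ⟨Nat.find hex, ?_, ?_, hspec, ?_⟩
    · by_contra h0
      have h0 : Nat.find hex = 0 := by omega
      rw [h0] at hspec
      simp at hspec
      omega
    · have := hbound _ hmin
      omega
    · intro p q _ hpq hq heq
      have h1 : φ^[q] i ≤ φ^[p + 1] i :=
        antitone_nat_of_succ_le (f := fun t => φ^[t] i) hanti (Nat.succ_le_of_lt hpq)
      have h2 := hanti p
      have h3 := hmin p (by omega)
      rw [hs] at h1 h2
      omega
  · refine ⟨1, le_rfl, hm, by simp [h], ?_⟩
    intros; omega
  · have hmon (t : ℕ) : φ^[t] i ≤ φ^[t + 1] i := by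
      induction t with
      | zero => simpa using h.le
      | succ t ih =>
        rcases ih.lt_or_eq with h' | h'
        · rw [hs (t + 1)]; nth_rewrite 1 [hs t]; exact hmono _ _ h' (hsm _)
        · rw [hs (t + 1), ← h', ← hs t]; exact h'.le
    have hbound (t : ℕ) (ht : ∀ r < t, φ (φ^[r] i) ≠ φ^[r] i) : i + t ≤ φ^[t] i := by
      induction t with
      | zero => simp
      | succ t ih =>
        have h1 := ih fun r hr => ht r (by omega)
        have h2 := ht t (by omega)
        have h3 := hmon t
        rw [hs] at h3 ⊢
        omega
    have hex : ∃ t, φ (φ^[t] i) = φ^[t] i := by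
      by_contra! hne
      have h1 := hbound (m + 1) fun r _ => hne r
      have h2 := hsm (m + 1)
      omega
    classical
    have hmin : ∀ r < Nat.find hex, φ (φ^[r] i) ≠ φ^[r] i := fun r hr => Nat.find_min hex hr
    have hspec := Nat.find_spec hex
    refine ⟨Nat.find hex, ?_, ?_, hspec, ?_⟩
    · by_contra h0
      have h0 : Nat.find hex = 0 := by omega
      rw [h0] at hspec
      simp at hspec
      omega
    · have h1 := hbound _ hmin
      have h2 := hsm (Nat.find hex)
      omega
    · intro p q _ hpq hq heq
      have h1 : φ^[p + 1] i ≤ φ^[q] i :=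
        monotone_nat_of_le_succ (f := fun t => φ^[t] i) hmon (Nat.succ_le_of_lt hpq)
      have h2 := hmon p
      have h3 := hmin p (by omega)
      rw [hs] at h1 h2
      omega

theorem Iter_one (f : ℝ → Set ℝ) (x : ℝ) : Iter f 1 x = f x := by
  simp [Iter]

theorem Iter_add (f : ℝ → Set ℝ) (p q : ℕ) (x : ℝ) :
    Iter f (p + q) x = ⋃ y ∈ Iter f p x, Iter f q y := by
  induction q with
  | zero => simp [Iter]
  | succ q ih =>
    rw [← add_assoc]
    simp only [Iter, ih]
    ext z
    simp only [mem_iUnion, exists_prop]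
    constructor
    · rintro ⟨y, ⟨w, hw, hy⟩, hz⟩
      exact ⟨w, hw, y, hy, hz⟩
    · rintro ⟨w, hw, y, hy, hz⟩
      exact ⟨y, ⟨w, hw, hy⟩, hz⟩

section MFOn

variable {a b : ℝ} {f : ℝ → Set ℝ}

theorem MFOn.iter_nonempty_and_subset (hf : MFOn a b f) (k : ℕ) {x : ℝ} (hx : x ∈ Icc a b) :
    (Iter f k x).Nonempty ∧ Iter f k x ⊆ Icc a b := by
  induction k with
  | zero => simpa [Iter] using hx
  | succ k ih =>
    obtain ⟨⟨y, hy⟩, hsub⟩ := ih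
    obtain ⟨z, hz⟩ := (hf y (hsub hy)).1
    exact ⟨⟨z, mem_iUnion₂.2 ⟨y, hy, hz⟩⟩, iUnion₂_subset fun w hw => (hf w (hsub hw)).2.2⟩

theorem MFOn.iter_nontrivial_succ (hf : MFOn a b f) (hinc : SIncOn a b f) {k : ℕ} {x : ℝ}
    (hx : x ∈ Icc a b) (h : (Iter f k x).Nontrivial) : (Iter f (k + 1) x).Nontrivial := by
  obtain ⟨u, hu, v, hv, huv⟩ := h.exists_lt
  have hsub := (hf.iter_nonempty_and_subset k hx).2
  obtain ⟨u', hu'⟩ := (hf u (hsub hu)).1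
  obtain ⟨v', hv'⟩ := (hf v (hsub hv)).1
  exact ⟨u', mem_iUnion₂.2 ⟨u, hu, hu'⟩, v', mem_iUnion₂.2 ⟨v, hv, hv'⟩,
    (hinc u (hsub hu) v (hsub hv) huv u' hu' v' hv').ne⟩

theorem MFOn.iter_nontrivial_mono (hf : MFOn a b f) (hinc : SIncOn a b f) {k l : ℕ} (hkl : k ≤ l)
    {x : ℝ} (hx : x ∈ Icc a b) (h : (Iter f k x).Nontrivial) : (Iter f l x).Nontrivial := by
  induction l, hkl using Nat.le_induction with
  | base => exact h
  | succ l _ ih => exact hf.iter_nontrivial_succ hinc hx ih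

end MFOn

theorem iter_root_mul {a b : ℝ} {F f : ℝ → Set ℝ} (hF : MFOn a b F) {n : ℕ}
    (hroot : ∀ x ∈ Icc a b, Iter f n x = F x) (k : ℕ) {x : ℝ} (hx : x ∈ Icc a b) :
    Iter f (k * n) x = Iter F k x := by
  induction k with
  | zero => simp [Iter]
  | succ k ih =>
    rw [Nat.succ_mul, Iter_add, ih]
    exact iUnion₂_congr fun y hy => hroot y ((hF.iter_nonempty_and_subset k hx).2 hy)

/-- For an exclusive strictly increasing multifunction, the second iterate has no new jumps. -/
theorem Exclusive.jumps_iter_two {a b : ℝ} {F : ℝ → Set ℝ} (hF : Exclusive a b F)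
    (hinc : SIncOn a b F) :
    (Jumps a b F).Nonempty ∧ Jumps a b (Iter F 2) = Jumps a b F := by
  obtain ⟨⟨hMF, -⟩, hfin, hmem, hleast⟩ := hF
  have h1 : Iter F 1 = F := funext (Iter_one F)
  have h0 : Jumps a b (Iter F 0) = ∅ := by ext x; simp [Jumps, Iter]
  have hpos : (Jumps a b F).ncard ≠ 0 := by
    intro h
    have hz : (0 : ℕ) ∈ {j : ℕ | (Jumps a b (Iter F j)).ncard =
        (Jumps a b (Iter F (j + 1))).ncard} := by
      simp [h0, h1, h]
    simpa using hleast hz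
  have heq : (Jumps a b F).ncard = (Jumps a b (Iter F 2)).ncard := by simpa [h1] using hmem
  have hsub : Jumps a b F ⊆ Jumps a b (Iter F 2) := fun x hx =>
    ⟨hx.1, hMF.iter_nontrivial_succ (k := 1) hinc hx.1 (h1.symm ▸ hx.2)⟩
  refine ⟨nonempty_of_ncard_ne_zero hpos, (eq_of_subset_of_ncard_le hsub heq.ge ?_).symm⟩
  exact finite_of_ncard_ne_zero (heq ▸ hpos)

/-- A root `f` of an exclusive multifunction `F` is single-valued off the jumps of `F`, and maps
the complement of the jumps into itself. -/
theorem exists_eq_singleton_of_notMem_jumps {a b : ℝ} {F f : ℝ → Set ℝ} (hF : Exclusive a b F)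
    (hFinc : SIncOn a b F) (hf : MFOn a b f) (hfinc : SIncOn a b f) {n : ℕ} (hn : 1 ≤ n)
    (hroot : ∀ x ∈ Icc a b, Iter f n x = F x) {x : ℝ} (hx : x ∈ Icc a b)
    (hxJ : x ∉ Jumps a b F) : ∃ y ∈ Icc a b, f x = {y} ∧ y ∉ Jumps a b F := by
  have h2 : ¬ (Iter f (2 * n) x).Nontrivial := by
    rw [iter_root_mul hF.1.1 hroot 2 hx]
    exact fun h => hxJ ((hF.jumps_iter_two hFinc).2 ▸ ⟨hx, h⟩)
  have hk (k : ℕ) (hkn : k ≤ 2 * n) : ¬ (Iter f k x).Nontrivial := fun h =>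
    h2 (hf.iter_nontrivial_mono hfinc hkn hx h)
  have h1 := hk 1 (by omega)
  rw [Iter_one, not_nontrivial_iff] at h1
  obtain ⟨y, hy⟩ := (hf x hx).1
  have hfx : f x = {y} := h1.eq_singleton_of_mem hy
  have hyI := (hf x hx).2.2 hy
  refine ⟨y, hyI, hfx, fun hyJ => hk (1 + n) (by omega) ?_⟩
  rw [Iter_add, Iter_one, hfx]
  simpa [hroot y hyI] using hyJ.2

section JumpEnum

variable {a b : ℝ} {F : ℝ → Set ℝ} {m : ℕ} {c : ℕ → ℝ}

theorem JumpEnum.lt_succ (hc : JumpEnum a b F m c) {i : ℕ} (hi : i ≤ m) : c i < c (i + 1) :=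
  hc.2.2.1 i (i + 1) (by omega) (by omega)

theorem JumpEnum.le_of_le (hc : JumpEnum a b F m c) {i j : ℕ} (hij : i ≤ j) (hj : j ≤ m + 1) :
    c i ≤ c j := by
  rcases hij.lt_or_eq with h | h
  · exact (hc.2.2.1 i j h hj).le
  · rw [h]

theorem JumpEnum.Ioo_subset (hc : JumpEnum a b F m c) {i : ℕ} (hi : i ≤ m) :
    Ioo (c i) (c (i + 1)) ⊆ Ioo a b := by
  rw [← hc.1, ← hc.2.1]
  exact Ioo_subset_Ioo (hc.le_of_le (by omega) (by omega)) (hc.le_of_le (by omega) le_rfl)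

theorem JumpEnum.lt_of_lt (hc : JumpEnum a b F m c) {i j : ℕ} (hij : i < j) (hj : j ≤ m)
    {x y : ℝ} (hx : x ∈ Ioo (c i) (c (i + 1))) (hy : y ∈ Ioo (c j) (c (j + 1))) : x < y :=
  hx.2.trans_le ((hc.le_of_le hij (by omega)).trans hy.1.le)

theorem JumpEnum.eq_of_mem (hc : JumpEnum a b F m c) {i j : ℕ} (hi : i ≤ m) (hj : j ≤ m)
    {x : ℝ} (hx : x ∈ Ioo (c i) (c (i + 1))) (hy : x ∈ Ioo (c j) (c (j + 1))) : i = j := by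
  rcases lt_trichotomy i j with h | h | h
  · exact absurd (hc.lt_of_lt h hj hx hy) (lt_irrefl _)
  · exact h
  · exact absurd (hc.lt_of_lt h hi hy hx) (lt_irrefl _)

theorem JumpEnum.notMem_jumps (hc : JumpEnum a b F m c) {i : ℕ} (hi : i ≤ m) {x : ℝ}
    (hx : x ∈ Ioo (c i) (c (i + 1))) : x ∉ Jumps a b F := by
  rw [hc.2.2.2]
  rintro ⟨j, -, hjm, rfl⟩
  rcases le_or_gt j i with h | h
  · exact (hc.le_of_le h (by omega)).not_gt hx.1
  · exact (hc.le_of_le (Nat.succ_le_of_lt h) (by omega)).not_gt hx.2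

theorem JumpEnum.exists_mem_Ioo (hc : JumpEnum a b F m c) {x : ℝ}
    (hx : x ∈ Ioo a b) (hxJ : x ∉ Jumps a b F) : ∃ i ≤ m, x ∈ Ioo (c i) (c (i + 1)) := by
  classical
  have hex : ∃ j, x < c j := ⟨m + 1, hc.2.1 ▸ hx.2⟩
  have hle : Nat.find hex ≤ m + 1 := Nat.find_le (hc.2.1 ▸ hx.2)
  have hspec := Nat.find_spec hex
  obtain ⟨i, hi⟩ : ∃ i, Nat.find hex = i + 1 := by
    refine Nat.exists_eq_succ_of_ne_zero fun h => ?_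
    rw [h, hc.1] at hspec
    exact hspec.not_gt hx.1
  have hci : c i ≤ x := not_lt.1 (Nat.find_min hex (by omega))
  refine ⟨i, by omega, hci.lt_of_ne fun h => ?_, hi ▸ hspec⟩
  rcases Nat.eq_zero_or_pos i with h0 | h0
  · rw [h0, hc.1] at h
    exact hx.1.ne h
  · exact hxJ (hc.2.2.2 ▸ ⟨i, h0, by omega, h.symm⟩)

end JumpEnum

/-- A root of an exclusive multifunction maps each interval between consecutive jumps into
another such interval. -/
theorem exists_imageOf_subset_Ioo {a b : ℝ} {F f : ℝ → Set ℝ} (hF : Exclusive a b F)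
    (hFinc : SIncOn a b F) {m : ℕ} {c : ℕ → ℝ} (hc : JumpEnum a b F m c) (hf : ClassF a b f)
    (hfinc : SIncOn a b f) {n : ℕ} (hn : 1 ≤ n) (hroot : ∀ x ∈ Icc a b, Iter f n x = F x)
    {i : ℕ} (hi : i ≤ m) :
    ∃ j ≤ m, ImageOf f (Ioo (c i) (c (i + 1))) ⊆ Ioo (c j) (c (j + 1)) := by
  set S := Ioo (c i) (c (i + 1))
  have hSI : S ⊆ Icc a b := (hc.Ioo_subset hi).trans Ioo_subset_Icc_self
  have hex (x : ℝ) : ∃ y, x ∈ S → y ∈ Icc a b ∧ f x = {y} ∧ y ∉ Jumps a b F := by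
    by_cases hx : x ∈ S
    · obtain ⟨y, hy⟩ := exists_eq_singleton_of_notMem_jumps hF hFinc hf.1 hfinc hn hroot
        (hSI hx) (hc.notMem_jumps hi hx)
      exact ⟨y, fun _ => hy⟩
    · exact ⟨0, fun h => absurd h hx⟩
  choose g hg using hex
  have hlt : StrictMonoOn g S := fun x hx y hy hxy =>
    hfinc x (hSI hx) y (hSI hy) hxy _ (by simp [(hg x hx).2.1]) _ (by simp [(hg y hy).2.1])
  have hcont : ContinuousOn g S := by
    intro x hx
    rw [ContinuousWithinAt, tendsto_nhds]
    intro V hV hgV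
    obtain ⟨U, hU, hUV⟩ := hf.2.1 x (hSI hx) V hV (by simpa [(hg x hx).2.1] using hgV)
    filter_upwards [inter_mem_nhdsWithin S hU] with y hy
    have := hUV y ⟨hy.2, hSI hy.1⟩
    rwa [(hg y hy.1).2.1, singleton_subset_iff] at this
  have hord : (g '' S).OrdConnected := (isPreconnected_Ioo.image g hcont).ordConnected
  have hopen (x : ℝ) (hx : x ∈ S) : g x ∈ Ioo a b := by
    obtain ⟨y, hy⟩ := exists_between hx.1
    obtain ⟨z, hz⟩ := exists_between hx.2
    have hyS : y ∈ S := ⟨hy.1, hy.2.trans hx.2⟩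
    have hzS : z ∈ S := ⟨hx.1.trans hz.1, hz.2⟩
    exact ⟨(hg y hyS).1.1.trans_lt (hlt hyS hx hy.2), (hlt hx hzS hz.1).trans_le (hg z hzS).1.2⟩
  have hidx (x : ℝ) (hx : x ∈ S) : ∃ j ≤ m, g x ∈ Ioo (c j) (c (j + 1)) :=
    hc.exists_mem_Ioo (hopen x hx) (hg x hx).2.2
  obtain ⟨x₀, hx₀⟩ := nonempty_Ioo.2 (hc.lt_succ hi)
  obtain ⟨j, hj, hxj⟩ := hidx x₀ hx₀
  have hle {x y : ℝ} (hx : x ∈ S) (hy : y ∈ S) {p q : ℕ} (hq : q ≤ m)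
      (hxp : g x ∈ Ioo (c p) (c (p + 1))) (hyq : g y ∈ Ioo (c q) (c (q + 1))) : q ≤ p := by
    by_contra! hpq
    have hmem : c (p + 1) ∈ g '' S := hord.out (mem_image_of_mem g hx) (mem_image_of_mem g hy)
      ⟨hxp.2.le, (hc.le_of_le hpq (by omega)).trans hyq.1.le⟩
    obtain ⟨z, hz, hzc⟩ := hmem
    exact (hg z hz).2.2 (hc.2.2.2 ▸ ⟨p + 1, by omega, by omega, hzc⟩)
  refine ⟨j, hj, iUnion₂_subset fun x hx => ?_⟩
  obtain ⟨k, hk, hxk⟩ := hidx x hx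
  rw [(hg x hx).2.1, singleton_subset_iff,
    le_antisymm (hle hx hx₀ hj hxk hxj) (hle hx₀ hx hk hxj hxk)]
  exact hxk


/-- a strictly increasing iterative root `f ∈ 𝓕(I)` of a strictly increasing
`F ∈ 𝓕₁(I)` has an invariant subinterval, and defines a correspondence
`κ_f : {0,…,m} → {1,…,m}` with the absorbing properties (i)-(iii) into some `K ∈ Λ(F)`. -/
theorem stmt8 (a b : ℝ) (hab : a < b) (F : ℝ → Set ℝ) (hF : Exclusive a b F)
    (hFinc : SIncOn a b F) (m : ℕ) (c : ℕ → ℝ) (hc : JumpEnum a b F m c)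
    (f : ℝ → Set ℝ) (hf : ClassF a b f) (hfinc : SIncOn a b f)
    (n : ℕ) (hn : 1 ≤ n) (hroot : ∀ x ∈ Icc a b, Iter f n x = F x) :
    (∃ i ≤ m, ImageOf f (Ioo (c i) (c (i + 1))) ⊆ Ioo (c i) (c (i + 1))) ∧
    ∃ κ : ℕ → ℕ, ∀ i ≤ m, 1 ≤ κ i ∧ κ i ≤ m ∧
      ∃ k ≤ m,
        ImageOf F (Ioo (c k) (c (k + 1))) ⊆ Ioo (c k) (c (k + 1)) ∧
        ImageOf (Iter f (κ i)) (Ioo (c i) (c (i + 1))) ⊆ Ioo (c k) (c (k + 1)) ∧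
        (∀ j : ℕ, 1 ≤ j → j ≤ κ i - 1 →
          ¬ ImageOf (Iter f j) (Ioo (c i) (c (i + 1))) ⊆ Ioo (c k) (c (k + 1))) ∧
        (∀ p q : ℕ, 1 ≤ p → p ≤ κ i → 1 ≤ q → q ≤ κ i → p ≠ q →
          ImageOf (Iter f p) (Ioo (c i) (c (i + 1))) ∩
            ImageOf (Iter f q) (Ioo (c i) (c (i + 1))) = ∅) := by
  have hMF : MFOn a b f := hf.1
  have hm : 1 ≤ m := by
    obtain ⟨x, hx⟩ := (hF.jumps_iter_two hFinc).1
    rw [hc.2.2.2] at hx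
    obtain ⟨j, h1, h2, -⟩ := hx
    omega
  have hex (i : ℕ) : ∃ j, i ≤ m →
      j ≤ m ∧ ImageOf f (Ioo (c i) (c (i + 1))) ⊆ Ioo (c j) (c (j + 1)) := by
    by_cases hi : i ≤ m
    · obtain ⟨j, hj⟩ := exists_imageOf_subset_Ioo hF hFinc hc hf hfinc hn hroot hi
      exact ⟨j, fun _ => hj⟩
    · exact ⟨0, fun h => absurd h hi⟩
  choose φ hφ using hex
  have hsub {i : ℕ} (hi : i ≤ m) : Ioo (c i) (c (i + 1)) ⊆ Icc a b :=
    (hc.Ioo_subset hi).trans Ioo_subset_Icc_self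
  have hmono (i j : ℕ) (hij : i < j) (hj : j ≤ m) : φ i ≤ φ j := by
    have hi : i ≤ m := by omega
    by_contra! hlt
    obtain ⟨x, hx⟩ := nonempty_Ioo.2 (hc.lt_succ hi)
    obtain ⟨y, hy⟩ := nonempty_Ioo.2 (hc.lt_succ hj)
    obtain ⟨u, hu⟩ := (hMF x (hsub hi hx)).1
    obtain ⟨v, hv⟩ := (hMF y (hsub hj hy)).1
    have huv := hfinc x (hsub hi hx) y (hsub hj hy) (hc.lt_of_lt hij hj hx hy) u hu v hv
    exact huv.not_gt (hc.lt_of_lt hlt (hφ i hi).1 ((hφ j hj).2 (mem_iUnion₂.2 ⟨y, hy, hv⟩))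
      ((hφ i hi).2 (mem_iUnion₂.2 ⟨x, hx, hu⟩)))
  have hiter {i : ℕ} (hi : i ≤ m) (t : ℕ) : φ^[t] i ≤ m ∧
      ImageOf (Iter f t) (Ioo (c i) (c (i + 1))) ⊆ Ioo (c (φ^[t] i)) (c (φ^[t] i + 1)) := by
    induction t with
    | zero => simp [hi, ImageOf, Iter]
    | succ t ih =>
      rw [Function.iterate_succ_apply']
      refine ⟨(hφ _ ih.1).1, iUnion₂_subset fun x hx => iUnion₂_subset fun y hy z hz => ?_⟩
      exact (hφ _ ih.1).2 (mem_iUnion₂.2 ⟨y, ih.2 (mem_iUnion₂.2 ⟨x, hx, hy⟩), hz⟩)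
  have horbit (i : ℕ) : ∃ κ, i ≤ m → 1 ≤ κ ∧ κ ≤ m ∧ φ (φ^[κ] i) = φ^[κ] i ∧
      ∀ p q, 1 ≤ p → p < q → q ≤ κ → φ^[p] i ≠ φ^[q] i := by
    by_cases hi : i ≤ m
    · obtain ⟨κ, hκ⟩ := exists_orbit_fixed_of_monotone hm φ (fun i hi => (hφ i hi).1) hmono i hi
      exact ⟨κ, fun _ => hκ⟩
    · exact ⟨0, fun h => absurd h hi⟩
  choose κ hκ using horbit
  refine ⟨?_, κ, fun i hi => ?_⟩
  · obtain ⟨-, -, hfix, -⟩ := hκ 0 (Nat.zero_le m)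
    have hle := (hiter (Nat.zero_le m) (κ 0)).1
    have himage := (hφ _ hle).2
    rw [hfix] at himage
    exact ⟨_, hle, himage⟩
  · obtain ⟨h1, h2, hfix, hinj⟩ := hκ i hi
    obtain ⟨hkm, hk⟩ := hiter hi (κ i)
    refine ⟨h1, h2, φ^[κ i] i, hkm, ?_, hk, fun j hj1 hj2 hj => ?_, ?_⟩
    · have hn' := (hiter hkm n).2
      rw [Function.iterate_fixed hfix n] at hn'
      refine iUnion₂_subset fun x hx => ?_
      rw [← hroot x (hsub hkm hx)]
      exact (subset_biUnion_of_mem (u := Iter f n) hx).trans hn'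
    · obtain ⟨x, hx⟩ := nonempty_Ioo.2 (hc.lt_succ hi)
      obtain ⟨y, hy⟩ := (hMF.iter_nonempty_and_subset j (hsub hi hx)).1
      have hyI : y ∈ ImageOf (Iter f j) (Ioo (c i) (c (i + 1))) := mem_iUnion₂.2 ⟨x, hx, hy⟩
      exact hinj j (κ i) hj1 (by omega) le_rfl
        (hc.eq_of_mem (hiter hi j).1 hkm ((hiter hi j).2 hyI) (hj hyI))
    · intro p q hp hpκ hq hqκ hpq
      refine eq_empty_of_forall_notMem fun y hy => ?_
      have heq := hc.eq_of_mem (hiter hi p).1 (hiter hi q).1 ((hiter hi p).2 hy.1)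
        ((hiter hi q).2 hy.2)
      rcases hpq.lt_or_gt with h | h
      · exact hinj p q hp h hqκ heq
      · exact hinj q p hq h hpκ heq.symm
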